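/- If A, A' ∈ GL(n,k) satisfy χ_ij(A) = χ_ij(A') for all 1 ≤ i ≤ p and 1 ≤ j ≤ q, then A and A' lie in the same double coset: there exist B ∈ T_-(β_1,...,β_q) and C ∈ T_+(α_1,...,α_p) with A' = B·A·C. (Injectivity part of Theorem 1.) -/

import Mathlib

namespace Neretin

open scoped BigOperators

variable {k : Type*} [Field k]

/-- Offset of the `i`-th block of the partition `α`. -/
def off {p : ℕ} (α : Fin p → ℕ) (i : Fin p) : ℕ := ∑ i' ∈ Finset.Iio i, α i'

theorem coord_lt {p n : ℕ} {α : Fin p → ℕ} (hα : ∑ i, α i = n) (i : Fin p)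
    (t : Fin (α i)) : off α i + (t : ℕ) < n := by
  have h1 : off α i + α i ≤ n := by
    rw [← hα]
    have h2 : insert i (Finset.Iio i) = Finset.Iic i := Finset.Iio_insert i
    have h3 : off α i + α i = ∑ i' ∈ Finset.Iic i, α i' := by
      rw [← h2, Finset.sum_insert (by simp)]
      unfold off
      omega
    rw [h3]
    exact Finset.sum_le_sum_of_subset (Finset.subset_univ _)
  have h4 := t.isLt
  omega

/-- The coordinate of `k^n` corresponding to the `t`-th coordinate of the `i`-th block. -/
def coord {p n : ℕ} {α : Fin p → ℕ} (hα : ∑ i, α i = n) (i : Fin p) (t : Fin (α i)) : Fin n :=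
  ⟨off α i + (t : ℕ), coord_lt hα i t⟩

/-- Subspace of vectors vanishing at all coordinates satisfying `P`. -/
def vanishOn {ι : Type*} (P : ι → Prop) : Submodule k (ι → k) :=
  ⨅ r ∈ {r : ι | P r}, LinearMap.ker (LinearMap.proj (R := k) (φ := fun _ : ι => k) r)

/-- The linear relation `χ_ij(A) : V_i ⇉ W_j`. -/
def chi {p q n : ℕ} (α : Fin p → ℕ) (β : Fin q → ℕ) (hα : ∑ i, α i = n) (hβ : ∑ j, β j = n)
    (A : Matrix (Fin n) (Fin n) k) (i : Fin p) (j : Fin q) :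
    Submodule k ((Fin (α i) → k) × (Fin (β j) → k)) :=
  Submodule.map
    ((LinearMap.funLeft k k (coord hα i)).prod
      ((LinearMap.funLeft k k (coord hβ j)).comp (Matrix.mulVecLin A)))
    (vanishOn (fun r : Fin n => off α i + α i ≤ (r : ℕ)) ⊓
      Submodule.comap (Matrix.mulVecLin A) (vanishOn fun r : Fin n => (r : ℕ) < off β j))

section Rel

variable {X Y : Type*} [AddCommGroup X] [Module k X] [AddCommGroup Y] [Module k Y]

/-- Kernel of a linear relation. -/
def rker (L : Submodule k (X × Y)) : Submodule k X := Submodule.comap (LinearMap.inl k X Y) L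

/-- Domain of a linear relation. -/
def rdom (L : Submodule k (X × Y)) : Submodule k X := Submodule.map (LinearMap.fst k X Y) L

/-- Image of a linear relation. -/
def rim (L : Submodule k (X × Y)) : Submodule k Y := Submodule.map (LinearMap.snd k X Y) L

/-- Indefiniteness of a linear relation. -/
def rindef (L : Submodule k (X × Y)) : Submodule k Y := Submodule.comap (LinearMap.inr k X Y) L

end Rel

/-- `blockLT α a b`: coordinate `a` lies in a strictly earlier block than `b`. -/
def blockLT {p : ℕ} (α : Fin p → ℕ) (a b : ℕ) : Prop :=
  ∃ i : Fin p, off α i ≤ b ∧ a < off α i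

/-- `sameBlock α a b` : coordinates `a`, `b` lie in the same block. -/
def sameBlock {p : ℕ} (α : Fin p → ℕ) (a b : ℕ) : Prop :=
  ∀ i : Fin p, off α i ≤ a ↔ off α i ≤ b

/-- Block upper triangular matrices (the group `P_+`). -/
def IsPPlus {n p : ℕ} (α : Fin p → ℕ) (g : Matrix (Fin n) (Fin n) k) : Prop :=
  ∀ r s : Fin n, blockLT α (s : ℕ) (r : ℕ) → g r s = 0

/-- Block lower triangular matrices (the group `P_-`). -/
def IsPMinus {n p : ℕ} (α : Fin p → ℕ) (g : Matrix (Fin n) (Fin n) k) : Prop :=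
  ∀ r s : Fin n, blockLT α (r : ℕ) (s : ℕ) → g r s = 0

/-- Block strictly upper triangular matrices (the group `T_+`). -/
def IsTPlus {n p : ℕ} (α : Fin p → ℕ) (g : Matrix (Fin n) (Fin n) k) : Prop :=
  IsPPlus α g ∧ ∀ r s : Fin n, sameBlock α (r : ℕ) (s : ℕ) → g r s = if r = s then 1 else 0

/-- Block strictly lower triangular matrices (the group `T_-`). -/
def IsTMinus {n p : ℕ} (α : Fin p → ℕ) (g : Matrix (Fin n) (Fin n) k) : Prop :=
  IsPMinus α g ∧ ∀ r s : Fin n, sameBlock α (r : ℕ) (s : ℕ) → g r s = if r = s then 1 else 0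

/-- Bi-hinges. -/
def IsBiHinge {p q : ℕ} (α : Fin p → ℕ) (β : Fin q → ℕ)
    (ξ : (i : Fin p) → (j : Fin q) → Submodule k ((Fin (α i) → k) × (Fin (β j) → k))) : Prop :=
  (∀ (i : Fin p) (j j' : Fin q), (j' : ℕ) = (j : ℕ) + 1 → rker (ξ i j) = rdom (ξ i j')) ∧
  (∀ (i i' : Fin p) (j : Fin q), (i' : ℕ) = (i : ℕ) + 1 → rim (ξ i j) = rindef (ξ i' j)) ∧
  (∀ (i : Fin p) (j : Fin q), (i : ℕ) = 0 → rindef (ξ i j) = ⊥) ∧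
  (∀ (i : Fin p) (j : Fin q), (i : ℕ) + 1 = p → rim (ξ i j) = ⊤) ∧
  (∀ (i : Fin p) (j : Fin q), (j : ℕ) + 1 = q → rker (ξ i j) = ⊥) ∧
  (∀ (i : Fin p) (j : Fin q), (j : ℕ) = 0 → rdom (ξ i j) = ⊤)

/-- 0-1 matrices with exactly one unit in each row and each column. -/
def IsPermMatrix {n : ℕ} (M : Matrix (Fin n) (Fin n) k) : Prop :=
  ∃ σ : Equiv.Perm (Fin n), ∀ r s, M r s = if r = σ s then 1 else 0

/-- Offset of the sub-block `V_i^j` inside `V_i`. -/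
def offA {p q : ℕ} (a : Fin p → Fin q → ℕ) (i : Fin p) (j : Fin q) : ℕ :=
  ∑ j' ∈ Finset.Iio j, a i j'

/-- Offset of the sub-block `W_j^i` inside `W_j`. -/
def offB {p q : ℕ} (a : Fin p → Fin q → ℕ) (i : Fin p) (j : Fin q) : ℕ :=
  ∑ i' ∈ Finset.Iio i, a i' j

open Classical in
/-- The standard 0-1 matrix determined by the dimension data `a`. -/
noncomputable def stdMatrix {p q : ℕ} (n : ℕ) (α : Fin p → ℕ) (β : Fin q → ℕ)
    (a : Fin p → Fin q → ℕ) : Matrix (Fin n) (Fin n) k :=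
  Matrix.of fun r s : Fin n =>
    if ∃ (i : Fin p) (j : Fin q) (t : ℕ), t < a i j ∧
        (s : ℕ) = off α i + offA a i j + t ∧ (r : ℕ) = off β j + offB a i j + t
      then (1 : k) else 0

/-- The standard bi-hinge determined by the dimension data `a`. -/
def stdHinge {p q : ℕ} (α : Fin p → ℕ) (β : Fin q → ℕ) (a : Fin p → Fin q → ℕ)
    (i : Fin p) (j : Fin q) : Submodule k ((Fin (α i) → k) × (Fin (β j) → k)) where
  carrier := {z | (∀ u : Fin (α i), (u : ℕ) < offA a i j → z.1 u = 0) ∧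
    (∀ v : Fin (β j), offB a i j + a i j ≤ (v : ℕ) → z.2 v = 0) ∧
    ∀ (u : Fin (α i)) (v : Fin (β j)) (t : ℕ), t < a i j →
      (u : ℕ) = offA a i j + t → (v : ℕ) = offB a i j + t → z.1 u = z.2 v}
  add_mem' := by
    rintro x y ⟨hx1, hx2, hx3⟩ ⟨hy1, hy2, hy3⟩
    refine ⟨fun u hu => ?_, fun v hv => ?_, fun u v t ht hu hv => ?_⟩
    · show x.1 u + y.1 u = 0
      rw [hx1 u hu, hy1 u hu, add_zero]
    · show x.2 v + y.2 v = 0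
      rw [hx2 v hv, hy2 v hv, add_zero]
    · show x.1 u + y.1 u = x.2 v + y.2 v
      rw [hx3 u v t ht hu hv, hy3 u v t ht hu hv]
  zero_mem' := ⟨fun _ _ => rfl, fun _ _ => rfl, fun _ _ _ _ _ _ => rfl⟩
  smul_mem' := by
    rintro c x ⟨hx1, hx2, hx3⟩
    refine ⟨fun u hu => ?_, fun v hv => ?_, fun u v t ht hu hv => ?_⟩
    · show c * x.1 u = 0
      rw [hx1 u hu, mul_zero]
    · show c * x.2 v = 0
      rw [hx2 v hv, mul_zero]
    · show c * x.1 u = c * x.2 v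
      rw [hx3 u v t ht hu hv]

theorem mem_vanishOn {ι : Type*} {P : ι → Prop} {x : ι → k} :
    x ∈ vanishOn (k := k) P ↔ ∀ r, P r → x r = 0 := by
  simp [vanishOn, Submodule.mem_iInf]

theorem off_add_self {p : ℕ} (α : Fin p → ℕ) (i : Fin p) :
    off α i + α i = ∑ i' ∈ Finset.Iic i, α i' := by
  rw [← Finset.Iio_insert i, Finset.sum_insert (by simp), off, add_comm]

theorem off_add_le {p : ℕ} (α : Fin p → ℕ) {i i' : Fin p} (h : i < i') :
    off α i + α i ≤ off α i' := by
  rw [off_add_self]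
  refine Finset.sum_le_sum_of_subset fun t ht => ?_
  rw [Finset.mem_Iic] at ht
  exact Finset.mem_Iio.2 (ht.trans_lt h)

theorem off_zero {p : ℕ} (α : Fin p → ℕ) (hp : 0 < p) : off α ⟨0, hp⟩ = 0 := by
  refine Finset.sum_eq_zero fun t ht => ?_
  exact absurd (Fin.lt_def.1 (Finset.mem_Iio.1 ht)) (Nat.not_lt_zero _)

theorem off_le_of_lt {p : ℕ} (α : Fin p → ℕ) {i i' : Fin p} {l : ℕ}
    (h : off α i' ≤ l) (h' : l < off α i + α i) : off α i' ≤ off α i := by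
  rcases lt_trichotomy i i' with hlt | rfl | hlt
  · have := off_add_le α hlt
    omega
  · exact le_rfl
  · have := off_add_le α hlt
    omega

/-- Every coordinate lies in some block. -/
theorem exists_block {p n : ℕ} {α : Fin p → ℕ} (hp : 0 < p) (hα : ∑ i, α i = n) (m : Fin n) :
    ∃ i, off α i ≤ m ∧ (m : ℕ) < off α i + α i := by
  obtain ⟨i, hi, hmax⟩ := (Finset.univ.filter fun i => off α i ≤ (m : ℕ)).exists_maximal
    ⟨⟨0, hp⟩, by simp [off_zero]⟩
  simp only [Finset.mem_filter, Finset.mem_univ, true_and] at hi hmax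
  refine ⟨i, hi, ?_⟩
  by_contra! hm
  rw [off_add_self] at hm
  by_cases h : (i : ℕ) + 1 < p
  · have hIio : Finset.Iio (⟨i + 1, h⟩ : Fin p) = Finset.Iic i := by
      ext t
      simp only [Finset.mem_Iio, Finset.mem_Iic, Fin.lt_def, Fin.le_def]
      omega
    have hle : (⟨i + 1, h⟩ : Fin p) ≤ i := hmax (by rwa [off, hIio]) (by simp [Fin.le_def])
    simp [Fin.le_def] at hle
  · have hIic : Finset.Iic i = Finset.univ := by
      ext t
      simp only [Finset.mem_Iic, Finset.mem_univ, iff_true, Fin.le_def]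
      omega
    rw [hIic, hα] at hm
    omega

theorem exists_coord {p n : ℕ} {α : Fin p → ℕ} (hα : ∑ i, α i = n) {i : Fin p} {r : Fin n}
    (h : off α i ≤ r) (h' : (r : ℕ) < off α i + α i) : ∃ t, coord hα i t = r :=
  ⟨⟨r - off α i, by omega⟩, Fin.ext (by simp only [coord]; omega)⟩

/-- Transporting a vector along an equality of linear relations `χ_ij`. -/
theorem exists_lift_of_chi_eq {p q n : ℕ} {α : Fin p → ℕ} {β : Fin q → ℕ}
    {hα : ∑ i, α i = n} {hβ : ∑ j, β j = n} {A A' : Matrix (Fin n) (Fin n) k}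
    {i : Fin p} {j : Fin q} (h : chi α β hα hβ A i j = chi α β hα hβ A' i j) {x : Fin n → k}
    (hx : ∀ r : Fin n, off α i + α i ≤ r → x r = 0)
    (hAx : ∀ r : Fin n, (r : ℕ) < off β j → (A.mulVec x) r = 0) :
    ∃ x' : Fin n → k, (∀ r : Fin n, off α i ≤ r → x' r = x r) ∧
      ∀ r : Fin n, (r : ℕ) < off β j + β j → (A'.mulVec x') r = (A.mulVec x) r := by
  have hmem : (x ∘ coord hα i, A.mulVec x ∘ coord hβ j) ∈ chi α β hα hβ A i j :=
    ⟨x, ⟨mem_vanishOn.2 hx, mem_vanishOn.2 hAx⟩, rfl⟩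
  rw [h] at hmem
  obtain ⟨x', ⟨hx', hAx'⟩, heq⟩ := hmem
  have hx' := mem_vanishOn.1 hx'
  have hAx' := mem_vanishOn.1 (Submodule.mem_comap.1 hAx')
  refine ⟨x', fun r hr => ?_, fun r hr => ?_⟩
  · by_cases hr' : off α i + α i ≤ r
    · rw [hx r hr', hx' r hr']
    · obtain ⟨t, rfl⟩ := exists_coord hα hr (not_le.1 hr')
      exact congrFun (congrArg Prod.fst heq) t
  · by_cases hr' : (r : ℕ) < off β j
    · rw [hAx r hr']
      exact hAx' r hr'
    · obtain ⟨t, rfl⟩ := exists_coord hβ (not_lt.1 hr') hr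
      exact congrFun (congrArg Prod.snd heq) t

theorem isTPlus_of_sub_one {p n : ℕ} {α : Fin p → ℕ} (hp : 0 < p) (hα : ∑ i, α i = n)
    {M : Matrix (Fin n) (Fin n) k}
    (h : ∀ (i : Fin p) (r s : Fin n), (s : ℕ) < off α i + α i → off α i ≤ r →
      (M - 1) r s = 0) : IsTPlus α M := by
  have h' : ∀ (i : Fin p) (r s : Fin n), (s : ℕ) < off α i + α i → off α i ≤ r →
      M r s = if r = s then 1 else 0 := fun i r s hs hr => by
    rw [← Matrix.one_apply]
    exact sub_eq_zero.1 (h i r s hs hr)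
  refine ⟨fun r s ⟨i, hr, hs⟩ => ?_, fun r s hrs => ?_⟩
  · rw [h' i r s (by omega) hr, if_neg (by rintro rfl; omega)]
  · obtain ⟨i, hi, hs⟩ := exists_block hp hα s
    exact h' i r s hs ((hrs i).2 hi)

theorem isTMinus_of_sub_one {q n : ℕ} {β : Fin q → ℕ} (hq : 0 < q) (hβ : ∑ j, β j = n)
    {M : Matrix (Fin n) (Fin n) k}
    (h : ∀ (j : Fin q) (r s : Fin n), (r : ℕ) < off β j + β j → off β j ≤ s →
      (M - 1) r s = 0) : IsTMinus β M := by
  have h' : ∀ (j : Fin q) (r s : Fin n), (r : ℕ) < off β j + β j → off β j ≤ s →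
      M r s = if r = s then 1 else 0 := fun j r s hr hs => by
    rw [← Matrix.one_apply]
    exact sub_eq_zero.1 (h j r s hr hs)
  refine ⟨fun r s ⟨j, hs, hr⟩ => ?_, fun r s hrs => ?_⟩
  · rw [h' j r s (by omega) hs, if_neg (by rintro rfl; omega)]
  · obtain ⟨j, hj, hr⟩ := exists_block hq hβ r
    exact h' j r s hr ((hrs j).1 hj)

/-- A matrix that is block strictly upper triangular modulo the identity is invertible, and its
inverse has the same property. -/
theorem isUnit_and_inv_sub_one {p n : ℕ} {α : Fin p → ℕ} (hp : 0 < p) (hα : ∑ i, α i = n)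
    {M : Matrix (Fin n) (Fin n) k}
    (h : ∀ (i : Fin p) (r s : Fin n), (s : ℕ) < off α i + α i → off α i ≤ r →
      (M - 1) r s = 0) :
    IsUnit M ∧ ∀ (i : Fin p) (r s : Fin n), (s : ℕ) < off α i + α i → off α i ≤ r →
      (M⁻¹ - 1) r s = 0 := by
  have hle : ∀ r s : Fin n, s ≤ r → M r s = (1 : Matrix (Fin n) (Fin n) k) r s := by
    intro r s hrs
    obtain ⟨i, hi, hr⟩ := exists_block hp hα r
    exact sub_eq_zero.1 (h i r s ((Fin.le_def.1 hrs).trans_lt hr) hi)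
  have hdet : M.det = 1 := by
    rw [Matrix.det_of_isUpperTriangular fun r s (hrs : s < r) => by
      rw [hle r s hrs.le, Matrix.one_apply_ne hrs.ne']]
    exact Finset.prod_eq_one fun r _ => by rw [hle r r le_rfl, Matrix.one_apply_eq]
  have hM : IsUnit M.det := hdet ▸ isUnit_one
  refine ⟨(Matrix.isUnit_iff_isUnit_det M).2 hM, fun i r s hs hr => ?_⟩
  let b : Fin n → ℕ := fun t => if (t : ℕ) < off α i + α i then 0 else 1
  have hb : M.BlockTriangular b := by
    intro t u htu
    have htu' : (u : ℕ) < off α i + α i ∧ off α i + α i ≤ t := by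
      simp only [b] at htu
      split_ifs at htu <;> omega
    rw [hle t u (Fin.le_def.2 (by omega)), Matrix.one_apply_ne (by rintro rfl; omega)]
  have : Invertible M := Matrix.invertibleOfIsUnitDet M hM
  have hinv := Matrix.blockTriangular_inv_of_blockTriangular hb
  have hfact : M⁻¹ - 1 = -((M - 1) * M⁻¹) := by
    rw [sub_mul, Matrix.mul_nonsing_inv M hM, one_mul, neg_sub]
  rw [hfact, Matrix.neg_apply, Matrix.mul_apply, neg_eq_zero]
  refine Finset.sum_eq_zero fun t _ => ?_
  by_cases ht : (t : ℕ) < off α i + α i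
  · rw [h i r t ht hr, zero_mul]
  · rw [hinv (show b s < b t by simp [b, hs, ht]), mul_zero]

/-- A family adapted both to the coordinate flag and to a descending family of subspaces `G j`:
the vector `v m` ends at the coordinate `m`, and vectors of `G j` are combinations of those `v l`
whose level is at least `j`. -/
theorem exists_adapted_family {q n : ℕ} (hq : 0 < q) (G : Fin q → Submodule k (Fin n → k))
    (hG : Antitone G) (htop : G ⟨0, hq⟩ = ⊤) :
    ∃ (v : Fin n → Fin n → k) (lvl : Fin n → Fin q),
      (∀ m r : Fin n, m < r → v m r = 0) ∧ (∀ m, v m m ≠ 0) ∧ (∀ m, v m ∈ G (lvl m)) ∧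
      ∀ (m : ℕ) (j : Fin q) (x : Fin n → k), (∀ r : Fin n, m ≤ r → x r = 0) → x ∈ G j →
        x ∈ Submodule.span k (v '' {l | (l : ℕ) < m ∧ j ≤ lvl l}) := by
  classical
  have key : ∀ m : Fin n, ∃ (w : Fin n → k) (j : Fin q), (∀ r, m < r → w r = 0) ∧ w m ≠ 0 ∧
      w ∈ G j ∧ ∀ (j' : Fin q) (x : Fin n → k), (∀ r, m < r → x r = 0) → x m ≠ 0 →
        x ∈ G j' → j' ≤ j := by
    intro m
    let S := Finset.univ.filter fun j : Fin q =>
      ∃ w : Fin n → k, (∀ r, m < r → w r = 0) ∧ w m ≠ 0 ∧ w ∈ G j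
    have hS : S.Nonempty := ⟨⟨0, hq⟩, Finset.mem_filter.2 ⟨Finset.mem_univ _, Pi.single m 1,
      fun r hr => Pi.single_eq_of_ne hr.ne' _, by simp, htop ▸ Submodule.mem_top⟩⟩
    obtain ⟨-, w, h1, h2, h3⟩ := Finset.mem_filter.1 (S.max'_mem hS)
    exact ⟨w, S.max' hS, h1, h2, h3, fun j' x hx hxm hxG =>
      S.le_max' _ (Finset.mem_filter.2 ⟨Finset.mem_univ _, x, hx, hxm, hxG⟩)⟩
  choose v lvl hv0 hv1 hvG hmax using key
  refine ⟨v, lvl, hv0, hv1, hvG, fun m => ?_⟩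
  induction m with
  | zero =>
    intro j x hx _
    rw [show x = 0 from funext fun r => hx r (Nat.zero_le _)]
    exact Submodule.zero_mem _
  | succ m ih =>
    intro j x hx hxG
    have hmono : Submodule.span k (v '' {l | (l : ℕ) < m ∧ j ≤ lvl l}) ≤
        Submodule.span k (v '' {l | (l : ℕ) < m + 1 ∧ j ≤ lvl l}) :=
      Submodule.span_mono (Set.image_mono fun l hl => ⟨hl.1.trans (Nat.lt_succ_self m), hl.2⟩)
    by_cases hzero : ∀ r : Fin n, m ≤ r → x r = 0
    · exact hmono (ih j x hzero hxG)
    push Not at hzero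
    obtain ⟨r, hr, hxr⟩ := hzero
    have hrm : (r : ℕ) = m := by
      by_contra hne
      exact hxr (hx r (by omega))
    have hj : j ≤ lvl r := hmax r j x (fun s hs => hx s (by omega)) hxr hxG
    have hmem := ih j (x - (x r / v r r) • v r) (fun s hs => ?_)
      (sub_mem hxG (Submodule.smul_mem _ _ (hG hj (hvG r))))
    · rw [← sub_add_cancel x ((x r / v r r) • v r)]
      exact add_mem (hmono hmem) (Submodule.smul_mem _ _ (Submodule.subset_span
        ⟨r, ⟨by omega, hj⟩, rfl⟩))
    · rcases eq_or_ne s r with rfl | hsr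
      · simp [hv1]
      · have hlt : r < s := Fin.lt_def.2 (by have := Fin.val_ne_of_ne hsr; omega)
        simp [hv0 r s hlt, hx s (by omega)]

theorem linearIndependent_of_triangular {n : ℕ} {v : Fin n → Fin n → k}
    (h0 : ∀ m r : Fin n, m < r → v m r = 0) (h1 : ∀ m, v m m ≠ 0) : LinearIndependent k v := by
  have hdet : IsUnit (Matrix.of v).det := by
    rw [Matrix.det_of_isLowerTriangular (Matrix.of v) fun m r hmr => h0 m r hmr]
    exact (Finset.prod_ne_zero_iff.2 fun m _ => h1 m).isUnit
  exact Matrix.linearIndependent_rows_iff_isUnit.2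
    ((Matrix.isUnit_iff_isUnit_det _).2 hdet)

theorem statement5 (p q n : ℕ) (hp : 0 < p) (hq : 0 < q)
    (α : Fin p → ℕ) (β : Fin q → ℕ)
    (hαpos : ∀ i, 0 < α i) (hβpos : ∀ j, 0 < β j)
    (hα : ∑ i, α i = n) (hβ : ∑ j, β j = n)
    (A A' : GL (Fin n) k)
    (hchi : ∀ (i : Fin p) (j : Fin q), chi α β hα hβ A.val i j = chi α β hα hβ A'.val i j) :
    ∃ B C : GL (Fin n) k, IsTMinus β B.val ∧ IsTPlus α C.val ∧ A' = B * A * C := by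
  let G : Fin q → Submodule k (Fin n → k) := fun j =>
    (vanishOn fun r : Fin n => (r : ℕ) < off β j).comap (Matrix.mulVecLin A.val)
  have memG : ∀ {j x}, x ∈ G j ↔ ∀ r : Fin n, (r : ℕ) < off β j → (A.val.mulVec x) r = 0 :=
    mem_vanishOn
  have hG : Antitone G := fun j j' hjj' x hx => memG.2 fun r hr => memG.1 hx r <| by
    rcases hjj'.eq_or_lt with rfl | hlt
    · exact hr
    · have := off_add_le β hlt
      omega
  obtain ⟨v, lvl, hv0, hv1, hvG, hspan⟩ := exists_adapted_family hq G hG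
    (eq_top_iff.2 fun x _ => memG.2 fun r hr => by rw [off_zero] at hr; omega)
  choose blk hblk hblk' using exists_block hp hα
  have hlift : ∀ m, _ := fun m => exists_lift_of_chi_eq (hchi (blk m) (lvl m)) (x := v m)
    (fun r hr => hv0 m r (Fin.lt_def.2 (by have := hblk' m; omega))) (memG.1 (hvG m))
  choose v' hv' hAv' using hlift
  have hli := linearIndependent_of_triangular hv0 hv1
  let b : Module.Basis (Fin n) k (Fin n → k) :=
    basisOfLinearIndependentOfCardEqFinrank' v hli (by simp)
  let D : Matrix (Fin n) (Fin n) k := LinearMap.toMatrix' (b.constr k v')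
  have hD : ∀ m, D.mulVec (v m) = v' m := fun m => by
    rw [← Matrix.toLin'_apply, Matrix.toLin'_toMatrix']
    have hbm : b m = v m := by simp [b]
    rw [← hbm, Module.Basis.constr_basis]
  have hDsub : ∀ (i : Fin p) (r s : Fin n), (s : ℕ) < off α i + α i → off α i ≤ r →
      (D - 1) r s = 0 := by
    intro i r s hs hr
    have hle : Submodule.span k (v '' {l | (l : ℕ) < off α i + α i ∧ ⟨0, hq⟩ ≤ lvl l}) ≤
        LinearMap.ker ((LinearMap.proj r).comp (Matrix.mulVecLin (D - 1))) := by
      rw [Submodule.span_le]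
      rintro _ ⟨l, ⟨hl, -⟩, rfl⟩
      simp only [SetLike.mem_coe, LinearMap.mem_ker, LinearMap.comp_apply, LinearMap.proj_apply,
        Matrix.mulVecLin_apply, Matrix.sub_mulVec, Matrix.one_mulVec, hD, Pi.sub_apply]
      rw [hv' l r ((off_le_of_lt α (hblk l) hl).trans hr), sub_self]
    have hmem := hle (hspan _ ⟨0, hq⟩ (Pi.single s 1) (fun t ht => Pi.single_eq_of_ne
      (by rintro rfl; omega) _) (memG.2 fun t ht => by rw [off_zero] at ht; omega))
    simpa [Matrix.one_apply, Pi.single_apply] using hmem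
  obtain ⟨hDu, hDinv⟩ := isUnit_and_inv_sub_one hp hα hDsub
  obtain ⟨U, hU⟩ := hDu
  refine ⟨A' * U * A⁻¹, U⁻¹, isTMinus_of_sub_one hq hβ ?_, isTPlus_of_sub_one hp hα ?_, by group⟩
  · intro j r s hr hs
    have hle : Submodule.span k (v '' {l | (l : ℕ) < n ∧ j ≤ lvl l}) ≤
        LinearMap.ker ((LinearMap.proj r).comp (Matrix.mulVecLin (A'.val * D - A.val))) := by
      rw [Submodule.span_le]
      rintro _ ⟨l, ⟨-, hl⟩, rfl⟩
      simp only [SetLike.mem_coe, LinearMap.mem_ker, LinearMap.comp_apply, LinearMap.proj_apply,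
        Matrix.mulVecLin_apply, Matrix.sub_mulVec, ← Matrix.mulVec_mulVec, hD, Pi.sub_apply]
      rw [hAv' l r, sub_self]
      rcases hl.eq_or_lt with rfl | hlt
      · exact hr
      · have := off_add_le β hlt
        omega
    have hAA : A.val * A⁻¹.val = 1 := A.mul_inv
    have hmem := hle (hspan n j (A⁻¹.val.mulVec (Pi.single s 1)) (fun t ht => by omega)
      (memG.2 fun t ht => by
        rw [Matrix.mulVec_mulVec, hAA, Matrix.one_mulVec]
        exact Pi.single_eq_of_ne (by rintro rfl; omega) _))
    rw [LinearMap.mem_ker, LinearMap.comp_apply, Matrix.mulVecLin_apply, Matrix.mulVec_mulVec,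
      sub_mul, hAA] at hmem
    simpa [hU] using hmem
  · rw [Matrix.coe_units_inv, hU]
    exact hDinv

end Neretin
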